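/- arXiv:1208.4237 — 4 statements merged into one kernel-verified Lean document; each statement's English description precedes it below -/
import Mathlib

section
/- Let k ≥ 1 and let G be a finite simple graph in which every vertex has degree at most 2k. Then the edge set of G can be partitioned into k classes E_1, …, E_k such that every vertex of G is incident to at most two edges from each class. -/
open Finset in
/-- A `k`-regular bipartite multigraph, with edges `S` and ends `a`, `b`, has a proper
edge colouring with `k` colours. -/
theorem exists_proper_edge_coloring_of_card_fibers {E V : Type*} [Fintype V] [DecidableEq V]
    [DecidableEq E] (a b : E → V) (k : ℕ) (S : Finset E)
    (ha : ∀ v, #{e ∈ S | a e = v} = k) (hb : ∀ v, #{e ∈ S | b e = v} = k) :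
    ∃ c : E → ℕ, (∀ e ∈ S, c e < k) ∧
      ∀ e ∈ S, ∀ e' ∈ S, c e = c e' → (a e = a e' ∨ b e = b e') → e = e' := by
  induction k generalizing S with
  | zero =>
    have hS : ∀ e, e ∉ S := fun e he => by
      have := ha (a e)
      rw [card_eq_zero, filter_eq_empty_iff] at this
      exact this he rfl
    exact ⟨fun _ => 0, fun e he => (hS e he).elim, fun e he => (hS e he).elim⟩
  | succ k ih =>
    have hall : ∀ X : Finset V,
        #X ≤ #(X.biUnion fun v => image b {e ∈ S | a e = v}) := fun X => by
      set Y := X.biUnion fun v => image b {e ∈ S | a e = v} with hY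
      have hX : #{e ∈ S | a e ∈ X} = #X * (k + 1) := by
        rw [card_eq_sum_card_fiberwise (f := a) (t := X) (fun e he => by simp_all),
          ← smul_eq_mul, ← sum_const]
        refine sum_congr rfl fun v hv => ?_
        rw [← ha v, filter_filter]
        congr 1
        grind
      have hY' : #{e ∈ S | b e ∈ Y} = #Y * (k + 1) := by
        rw [card_eq_sum_card_fiberwise (f := b) (t := Y) (fun e he => by simp_all),
          ← smul_eq_mul, ← sum_const]
        refine sum_congr rfl fun v hv => ?_
        rw [← hb v, filter_filter]
        congr 1
        grind
      have hXY : #{e ∈ S | a e ∈ X} ≤ #{e ∈ S | b e ∈ Y} := by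
        refine card_le_card fun e he => ?_
        simp only [mem_filter, hY, mem_biUnion, mem_image] at he ⊢
        exact ⟨he.1, a e, he.2, e, ⟨he.1, rfl⟩, rfl⟩
      rw [hX, hY'] at hXY
      exact Nat.le_of_mul_le_mul_right hXY k.succ_pos
    obtain ⟨g, hg, hgm⟩ := (all_card_le_biUnion_card_iff_exists_injective _).1 hall
    simp only [mem_image, mem_filter] at hgm
    choose f hf hfb using hgm
    have hg' : Function.Surjective g := Finite.surjective_of_injective hg
    set M := image f univ with hM
    have hremove (h : E → V) (hfib : ∀ v, #{e ∈ S | h e = v} = k + 1)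
        (hinj : Function.Bijective (h ∘ f)) (v : V) : #{e ∈ S \ M | h e = v} = k := by
      obtain ⟨u, hu⟩ := hinj.2 v
      have : ({e ∈ S \ M | h e = v} : Finset E) = ({e ∈ S | h e = v} : Finset E).erase (f u) := by
        ext e
        simp only [mem_filter, mem_sdiff, mem_erase, hM, mem_image, mem_univ, true_and]
        constructor
        · rintro ⟨⟨h1, h2⟩, h3⟩
          exact ⟨fun h => h2 ⟨u, h.symm⟩, h1, h3⟩
        · rintro ⟨h1, h2, h3⟩
          refine ⟨⟨h2, ?_⟩, h3⟩
          rintro ⟨w, rfl⟩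
          exact h1 (congrArg f (hinj.1 (h3.trans hu.symm)))
      rw [this, card_erase_of_mem (by simpa using ⟨(hf u).1, hu⟩), hfib]
      rfl
    have haf : a ∘ f = id := funext fun v => (hf v).2
    have hbf : b ∘ f = g := funext hfb
    obtain ⟨c, hc, hcinj⟩ := ih (S \ M)
      (hremove a ha (haf ▸ Function.bijective_id)) (hremove b hb (hbf ▸ ⟨hg, hg'⟩))
    refine ⟨fun e => if e ∈ M then k else c e, fun e he => ?_, fun e he e' he' hce hab => ?_⟩
    · dsimp only
      split_ifs with h
      · exact k.lt_succ_self
      · exact (hc e (mem_sdiff.2 ⟨he, h⟩)).trans k.lt_succ_self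
    · dsimp only at hce
      split_ifs at hce with h h' h'
      · simp only [hM, mem_image, mem_univ, true_and] at h h'
        obtain ⟨u, rfl⟩ := h
        obtain ⟨w, rfl⟩ := h'
        rw [(hf u).2, (hf w).2, hfb, hfb, hg.eq_iff, or_self] at hab
        rw [hab]
      · exact absurd hce (hc e' (mem_sdiff.2 ⟨he', h'⟩)).ne'
      · exact absurd hce (hc e (mem_sdiff.2 ⟨he, h⟩)).ne
      · exact hcinj e (mem_sdiff.2 ⟨he, h⟩) e' (mem_sdiff.2 ⟨he', h'⟩) hce hab

open Finset in
/-- A `2 * k`-regular multigraph with ends `s`, `t` has an orientation in which every vertex has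
in-degree and out-degree `k`. -/
theorem exists_balanced_orientation {E V : Type*} [Fintype E] [Fintype V] [DecidableEq V]
    (s t : E → V) (k : ℕ) (h : ∀ v, #{e | s e = v} + #{e | t e = v} = 2 * k) :
    ∃ a b : E → V, (∀ e, a e = s e ∧ b e = t e ∨ a e = t e ∧ b e = s e) ∧
      (∀ v, #{e | a e = v} = k) ∧ ∀ v, #{e | b e = v} = k := by
  have hall : ∀ S : Finset E,
      #S ≤ #(S.biUnion fun e => ({s e, t e} : Finset V) ×ˢ (univ : Finset (Fin k))) := fun S => by
    set T := S.biUnion fun e => ({s e, t e} : Finset V) with hT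
    have hST : (S.biUnion fun e => ({s e, t e} : Finset V) ×ˢ (univ : Finset (Fin k))) =
        T ×ˢ univ := by
      ext ⟨v, i⟩
      simp [hT]
    have hs : #S = ∑ v ∈ T, #{e ∈ S | s e = v} :=
      card_eq_sum_card_fiberwise fun e he => by
        simp only [hT, coe_biUnion, Set.mem_iUnion]
        exact ⟨e, he, by simp⟩
    have ht : #S = ∑ v ∈ T, #{e ∈ S | t e = v} :=
      card_eq_sum_card_fiberwise fun e he => by
        simp only [hT, coe_biUnion, Set.mem_iUnion]
        exact ⟨e, he, by simp⟩
    have hle : ∑ v ∈ T, (#{e ∈ S | s e = v} + #{e ∈ S | t e = v}) ≤ ∑ v ∈ T, 2 * k := by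
      refine sum_le_sum fun v _ => ?_
      rw [← h v]
      gcongr <;> exact subset_univ S
    rw [sum_add_distrib, ← hs, ← ht, sum_const, smul_eq_mul] at hle
    rw [hST, card_product, card_univ, Fintype.card_fin]
    linarith
  obtain ⟨f, hf, hfm⟩ := (all_card_le_biUnion_card_iff_exists_injective _).1 hall
  have hcard : Fintype.card E = Fintype.card (V × Fin k) := by
    have hs : #(univ : Finset E) = ∑ v, #{e | s e = v} :=
      card_eq_sum_card_fiberwise fun e _ => by simp
    have ht : #(univ : Finset E) = ∑ v, #{e | t e = v} :=
      card_eq_sum_card_fiberwise fun e _ => by simp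
    have hsum := sum_congr (rfl : (univ : Finset V) = univ) fun v _ => h v
    rw [sum_add_distrib, ← hs, ← ht, sum_const, smul_eq_mul, card_univ, card_univ] at hsum
    rw [Fintype.card_prod, Fintype.card_fin]
    linarith
  have hfb : Function.Bijective f := (Fintype.bijective_iff_injective_and_card f).2 ⟨hf, hcard⟩
  have ha : ∀ v, #{e | (f e).1 = v} = k := fun v => by
    have : #{e | (f e).1 = v} = #(univ : Finset (Fin k)) := by
      refine card_bij (fun e _ => (f e).2) (fun _ _ => mem_univ _) (fun e he e' he' hee => ?_)
        fun i _ => ?_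
      · simp only [mem_filter, mem_univ, true_and] at he he'
        exact hf (Prod.ext (he.trans he'.symm) hee)
      · obtain ⟨e, he⟩ := hfb.2 (v, i)
        exact ⟨e, by simp [he], by simp [he]⟩
    rw [this, card_univ, Fintype.card_fin]
  have hfst : ∀ e, (f e).1 = s e ∨ (f e).1 = t e := fun e => by simpa using hfm e
  refine ⟨fun e => (f e).1, fun e => if (f e).1 = s e then t e else s e, fun e => ?_, ha,
    fun v => ?_⟩
  · have := hfst e
    dsimp only
    split_ifs <;> grind
  · have hv := h v
    have hav := ha v
    have : #{e | (f e).1 = v} + #{e | (if (f e).1 = s e then t e else s e) = v} =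
        #{e | s e = v} + #{e | t e = v} := by
      simp only [card_filter, ← sum_add_distrib]
      refine sum_congr rfl fun e _ => ?_
      have := hfst e
      grind
    dsimp only
    omega

open Finset in
/-- **Petersen's 2-factor theorem** for multigraphs, in the form of an edge colouring. -/
theorem exists_edge_coloring_of_regular {E V : Type*} [Fintype E] [Fintype V] [DecidableEq V]
    (s t : E → V) (k : ℕ) (h : ∀ v, #{e | s e = v} + #{e | t e = v} = 2 * k) :
    ∃ c : E → Fin k, ∀ v j, #{e | c e = j ∧ (s e = v ∨ t e = v)} ≤ 2 := by
  classical
  obtain ⟨a, b, hab, ha, hb⟩ := exists_balanced_orientation s t k h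
  obtain ⟨c, hc, hinj⟩ := exists_proper_edge_coloring_of_card_fibers a b k univ ha hb
  refine ⟨fun e => ⟨c e, hc e (mem_univ e)⟩, fun v j => ?_⟩
  have hsub : ({e | (⟨c e, hc e (mem_univ e)⟩ : Fin k) = j ∧ (s e = v ∨ t e = v)} : Finset E) ⊆
      ({e | c e = j ∧ a e = v} : Finset E) ∪ ({e | c e = j ∧ b e = v} : Finset E) := fun e he => by
    simp only [mem_union, mem_filter, mem_univ, true_and, Fin.ext_iff] at he ⊢
    have := hab e
    grind
  have h1 : #{e | c e = j ∧ a e = v} ≤ 1 := card_le_one.2 fun e he e' he' => by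
    simp only [mem_filter, mem_univ, true_and] at he he'
    exact hinj e (mem_univ e) e' (mem_univ e') (he.1.trans he'.1.symm)
      (Or.inl (he.2.trans he'.2.symm))
  have h2 : #{e | c e = j ∧ b e = v} ≤ 1 := card_le_one.2 fun e he e' he' => by
    simp only [mem_filter, mem_univ, true_and] at he he'
    exact hinj e (mem_univ e) e' (mem_univ e') (he.1.trans he'.1.symm)
      (Or.inr (he.2.trans he'.2.symm))
  have := (card_le_card hsub).trans (card_union_le _ _)
  dsimp only
  omega

open Finset in
/-- The edges of a multigraph of maximum degree at most `2 * k` can be coloured with `k` colours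
so that every vertex meets at most two edges of each colour. The proof embeds the multigraph in a
`2 * k`-regular one: two disjoint copies, with the two copies of each vertex `v` joined by
`2 * k - deg v` parallel edges. -/
theorem exists_edge_coloring_of_degree_le {E V : Type*} [Fintype E] [Fintype V] [DecidableEq V]
    (s t : E → V) (k : ℕ) (h : ∀ v, #{e | s e = v} + #{e | t e = v} ≤ 2 * k) :
    ∃ c : E → Fin k, ∀ v j, #{e | c e = j ∧ (s e = v ∨ t e = v)} ≤ 2 := by
  classical
  let d : V → ℕ := fun v => 2 * k - (#{e | s e = v} + #{e | t e = v})
  let s' : (E × Bool) ⊕ (Σ v, Fin (d v)) → V × Bool :=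
    Sum.elim (fun e => (s e.1, e.2)) fun x => (x.1, false)
  let t' : (E × Bool) ⊕ (Σ v, Fin (d v)) → V × Bool :=
    Sum.elim (fun e => (t e.1, e.2)) fun x => (x.1, true)
  have hfib (r : E → V) (v : V) (i j : Bool) :
      #{e | Sum.elim (fun e : E × Bool => (r e.1, e.2))
        (fun x : Σ v, Fin (d v) => (x.1, j)) e = (v, i)} =
        #{e | r e = v} + if j = i then d v else 0 := by
    rw [card_filter, Fintype.sum_sum_type]
    simp only [Sum.elim_inl, Sum.elim_inr, Prod.mk.injEq]
    congr 1
    · rw [Fintype.sum_prod_type, card_filter]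
      refine sum_congr rfl fun e _ => ?_
      rw [Fintype.sum_bool]
      cases i <;> simp
    · rw [Fintype.sum_sigma]
      by_cases hji : j = i <;> simp [hji]
  have hreg : ∀ w, #{e | s' e = w} + #{e | t' e = w} = 2 * k := by
    rintro ⟨v, i⟩
    have hv := h v
    rw [hfib, hfib]
    cases i <;> simp [d] <;> omega
  obtain ⟨c, hc⟩ := exists_edge_coloring_of_regular s' t' k hreg
  refine ⟨fun e => c (Sum.inl (e, false)), fun v j => (card_le_card_of_injOn
    (fun e => Sum.inl (e, false)) (fun e he => ?_) fun e _ e' _ hee => ?_).trans (hc (v, false) j)⟩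
  · simpa [s', t'] using he
  · simpa using hee

/-- **Petersen's lemma.** If every vertex of a finite simple graph `G` has degree at most
`2 * k` (with `k ≥ 1`), then the edge set of `G` can be partitioned into `k` classes such that
every vertex is incident to at most two edges from each class. -/
theorem petersen_edge_partition {V : Type*} [Fintype V] [DecidableEq V]
    (G : SimpleGraph V) [DecidableRel G.Adj] (k : ℕ) (hk : 1 ≤ k)
    (hdeg : ∀ v : V, G.degree v ≤ 2 * k) :
    ∃ c : G.edgeSet → Fin k,
      ∀ (v : V) (j : Fin k),
        {e : G.edgeSet | c e = j ∧ v ∈ (e : Sym2 V)}.ncard ≤ 2 := by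
  classical
  let s : G.edgeSet → V := fun e => (Quot.out (e : Sym2 V)).1
  let t : G.edgeSet → V := fun e => (Quot.out (e : Sym2 V)).2
  have hst (e : G.edgeSet) : s(s e, t e) = e := Quot.out_eq (e : Sym2 V)
  have hmem (v : V) (e : G.edgeSet) : v ∈ (e : Sym2 V) ↔ s e = v ∨ t e = v := by
    rw [← hst e, Sym2.mem_iff, eq_comm, @eq_comm _ v (t e)]
  have hne (e : G.edgeSet) : s e ≠ t e := by
    have := e.2
    rw [← hst e, SimpleGraph.mem_edgeSet] at this
    exact this.ne
  obtain ⟨c, hc⟩ := exists_edge_coloring_of_degree_le s t k fun v => by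
    refine le_trans ?_ (hdeg v)
    rw [← Finset.card_union_of_disjoint, ← G.card_incidenceFinset_eq_degree]
    · refine Finset.card_le_card_of_injOn (fun e => (e : Sym2 V)) (fun e he => ?_)
        Subtype.val_injective.injOn
      simp only [Finset.coe_union, Finset.coe_filter, Finset.mem_univ, true_and,
        Set.mem_union, Set.mem_ofPred_eq, ← hmem] at he
      simpa [SimpleGraph.incidenceSet] using he
    · refine Finset.disjoint_filter.2 fun e _ h1 h2 => hne e (h1.trans h2.symm)
  refine ⟨c, fun v j => ?_⟩
  simp only [hmem]
  rw [Set.ncard_eq_toFinset_card']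
  simpa using hc v j
end

section
/- Let k ≥ 1 and let G be a finite simple graph on a vertex set V in which every vertex has degree at most 2k. Then there exist k partial bijections f_1, …, f_k of V (injective maps defined on subsets of V) such that: (i) for each j and each x in the domain of f_j, x is adjacent to f_j(x) in G; (ii) for each j, f_j has no 2-cycles, i.e. if f_j(x) = y and y lies in the domain of f_j then f_j(y) ≠ x; (iii) the sets of edges realized by distinct f_j are disjoint; and (iv) every edge {x,y} of G is realized by some f_j, meaning x is in the domain of f_j with f_j(x) = y, or y is in the domain of f_j with f_j(y) = x. -/
/-- A functional relation is the graph of an `Option`-valued function. -/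
theorem exists_option_eq_some_iff {α β : Type*} (R : α → β → Prop)
    (hfun : ∀ x y y', R x y → R x y' → y = y') :
    ∃ f : α → Option β, ∀ x y, f x = some y ↔ R x y := by
  classical
  refine ⟨fun x => if h : ∃ y, R x y then some h.choose else none, fun x y => ?_⟩
  by_cases h : ∃ y, R x y
  · simp only [h, dif_pos, Option.some.injEq]
    exact ⟨fun e => e ▸ h.choose_spec, fun e => hfun _ _ _ h.choose_spec e⟩
  · simp only [h, dif_neg, not_false_eq_true, reduceCtorEq, false_iff]
    exact fun e => h ⟨y, e⟩

/-- A relation that is functional in both directions is the graph of a partial equivalence. -/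
theorem PEquiv.exists_eq_some_iff {α β : Type*} (R : α → β → Prop)
    (hfun : ∀ x y y', R x y → R x y' → y = y') (hinj : ∀ x x' y, R x y → R x' y → x = x') :
    ∃ f : PEquiv α β, ∀ x y, f x = some y ↔ R x y := by
  obtain ⟨f, hf⟩ := exists_option_eq_some_iff R hfun
  obtain ⟨g, hg⟩ := exists_option_eq_some_iff (fun y x => R x y) fun y x x' => hinj x x' y
  exact ⟨⟨f, g, fun x y => by simp [hf, hg]⟩, hf⟩

/-- A finite multigraph (with loops counted twice) all of whose degrees are `2 * k` has an
orientation all of whose in-degrees and out-degrees are `k`. -/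
theorem exists_balanced_orientation_s1 {E W : Type*} [Fintype E] [Fintype W] [DecidableEq W]
    (k : ℕ) (s t : E → W)
    (hdeg : ∀ w, Fintype.card {e // s e = w} + Fintype.card {e // t e = w} = 2 * k) :
    ∃ tail head : E → W,
      (∀ e, tail e = s e ∧ head e = t e ∨ tail e = t e ∧ head e = s e) ∧
      (∀ w, Fintype.card {e // tail e = w} = k) ∧ ∀ w, Fintype.card {e // head e = w} = k := by
  classical
  simp only [Fintype.card_subtype] at hdeg ⊢
  have hall : ∀ S : Finset E,
      S.card ≤
        (S.biUnion fun e => ({s e, t e} : Finset W) ×ˢ (Finset.univ : Finset (Fin k))).card := by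
    intro S
    have hN : (S.biUnion fun e => ({s e, t e} : Finset W) ×ˢ (Finset.univ : Finset (Fin k))) =
        (S.biUnion fun e => ({s e, t e} : Finset W)) ×ˢ Finset.univ := by
      ext ⟨w, i⟩; simp
    rw [hN, Finset.card_product, Finset.card_univ, Fintype.card_fin]
    set N := S.biUnion fun e => ({s e, t e} : Finset W) with hNdef
    have hs : S.card = ∑ w ∈ N, (S.filter fun e => s e = w).card :=
      Finset.card_eq_sum_card_fiberwise fun e he => by
        simp only [hNdef, Finset.coe_biUnion, Set.mem_iUnion]; exact ⟨e, he, by simp⟩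
    have ht : S.card = ∑ w ∈ N, (S.filter fun e => t e = w).card :=
      Finset.card_eq_sum_card_fiberwise fun e he => by
        simp only [hNdef, Finset.coe_biUnion, Set.mem_iUnion]; exact ⟨e, he, by simp⟩
    have hle : ∑ w ∈ N, ((S.filter fun e => s e = w).card + (S.filter fun e => t e = w).card) ≤
        ∑ _w ∈ N, 2 * k := by
      refine Finset.sum_le_sum fun w _ => ?_
      rw [← hdeg w]
      gcongr <;> exact Finset.subset_univ _
    rw [Finset.sum_add_distrib, ← hs, ← ht, Finset.sum_const, smul_eq_mul] at hle
    linarith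
  obtain ⟨g, hginj, hg⟩ := (Finset.all_card_le_biUnion_card_iff_exists_injective _).1 hall
  have hcard : Fintype.card E = Fintype.card (W × Fin k) := by
    have hs : Fintype.card E = ∑ w, (Finset.univ.filter fun e => s e = w).card :=
      Finset.card_eq_sum_card_fiberwise fun e _ => by simp
    have ht : Fintype.card E = ∑ w, (Finset.univ.filter fun e => t e = w).card :=
      Finset.card_eq_sum_card_fiberwise fun e _ => by simp
    have h := Finset.sum_congr rfl fun w (_ : w ∈ Finset.univ) => hdeg w
    rw [Finset.sum_add_distrib, ← hs, ← ht, Finset.sum_const, smul_eq_mul, Finset.card_univ] at h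
    rw [Fintype.card_prod, Fintype.card_fin]
    linarith
  have hgbij : Function.Bijective g := (Fintype.bijective_iff_injective_and_card g).2 ⟨hginj, hcard⟩
  have hmem : ∀ e, (g e).1 = s e ∨ (g e).1 = t e := fun e => by simpa using hg e
  have hhead : ∀ w, (Finset.univ.filter fun e => (g e).1 = w).card = k := by
    intro w
    have h : ((Finset.univ.filter fun e => (g e).1 = w).map ⟨g, hginj⟩) =
        ({w} : Finset W) ×ˢ (Finset.univ : Finset (Fin k)) := by
      ext ⟨w', i⟩
      simp only [Finset.mem_map, Finset.mem_filter, Finset.mem_univ, true_and,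
        Function.Embedding.coeFn_mk, Finset.mem_product, Finset.mem_singleton, and_true]
      constructor
      · rintro ⟨e, rfl, he⟩; rw [he]
      · rintro rfl
        obtain ⟨e, he⟩ := hgbij.2 (w', i)
        exact ⟨e, by rw [he], he⟩
    rw [← Finset.card_map ⟨g, hginj⟩, h]
    simp
  refine ⟨fun e => if (g e).1 = s e then t e else s e, fun e => (g e).1, fun e => ?_, fun w => ?_,
    hhead⟩
  · have := hmem e
    by_cases h : (g e).1 = s e
    · simp [h]
    · simp [h]; tauto
  · have hsum : (Finset.univ.filter fun e => (if (g e).1 = s e then t e else s e) = w).card +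
        (Finset.univ.filter fun e => (g e).1 = w).card = 2 * k := by
      rw [← hdeg w]
      simp only [Finset.card_filter, ← Finset.sum_add_distrib]
      refine Finset.sum_congr rfl fun e _ => ?_
      have := hmem e
      by_cases h : (g e).1 = s e
      · simp only [h, if_true]; omega
      · rw [if_neg h, this.resolve_left h]
    rw [hhead w] at hsum
    have : (Finset.univ.filter fun e => (if (g e).1 = s e then t e else s e) = w).card = k := by
      omega
    exact this

/-- The edges of a finite `k`-regular bipartite multigraph can be properly coloured with `k`
colours. -/
theorem exists_edge_coloring_of_regular_s1 {E W : Type*} [Fintype W] [DecidableEq W]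
    (tail head : E → W) (k : ℕ) (F : Finset E)
    (htail : ∀ w, (F.filter fun e => tail e = w).card = k)
    (hhead : ∀ w, (F.filter fun e => head e = w).card = k) :
    ∃ c : E → ℕ, (∀ e ∈ F, c e < k) ∧
      ∀ e ∈ F, ∀ e' ∈ F, c e = c e' → tail e = tail e' ∨ head e = head e' → e = e' := by
  classical
  induction k generalizing F with
  | zero =>
    have hF : ∀ e, e ∉ F := fun e he => by
      have := htail (tail e)
      rw [Finset.card_eq_zero] at this
      exact Finset.notMem_empty e (this ▸ Finset.mem_filter.2 ⟨he, rfl⟩)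
    exact ⟨fun _ => 0, fun e he => (hF e he).elim, fun e he => (hF e he).elim⟩
  | succ k ih =>
    have hall : ∀ S : Finset W,
        S.card ≤ (S.biUnion fun w => (F.filter fun e => tail e = w).image head).card := by
      intro S
      set N := S.biUnion fun w => (F.filter fun e => tail e = w).image head with hN
      have h1 : (F.filter fun e => tail e ∈ S).card = ∑ w ∈ S, (k + 1) := by
        rw [Finset.card_eq_sum_card_fiberwise (t := S) (f := tail) fun e he => by
          simpa using (Finset.mem_filter.1 he).2]
        refine Finset.sum_congr rfl fun w hw => ?_
        rw [← htail w, Finset.filter_filter]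
        congr 1
        exact Finset.filter_congr fun e _ => ⟨fun h => h.2, fun h => ⟨h ▸ hw, h⟩⟩
      have h2 : (F.filter fun e => tail e ∈ S).card ≤ ∑ w ∈ N, (k + 1) := by
        rw [Finset.card_eq_sum_card_fiberwise (t := N) (f := head) fun e he => by
          have he' := Finset.mem_filter.1 he
          exact Finset.mem_biUnion.2 ⟨tail e, he'.2,
            Finset.mem_image_of_mem _ (Finset.mem_filter.2 ⟨he'.1, rfl⟩)⟩]
        refine Finset.sum_le_sum fun w _ => ?_
        rw [← hhead w]
        exact Finset.card_le_card (Finset.filter_subset_filter _ (Finset.filter_subset _ _))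
      rw [h1, Finset.sum_const, Finset.sum_const, smul_eq_mul, smul_eq_mul] at h2
      exact Nat.le_of_mul_le_mul_right h2 k.succ_pos
    obtain ⟨g, hginj, hg⟩ := (Finset.all_card_le_biUnion_card_iff_exists_injective _).1 hall
    have hgbij := Finite.injective_iff_bijective.1 hginj
    simp only [Finset.mem_image, Finset.mem_filter] at hg
    choose m hm hmg using hg
    set M := Finset.univ.image m with hM
    have hmM : ∀ w, m w ∈ M := fun w => Finset.mem_image_of_mem _ (Finset.mem_univ w)
    have hMtail : ∀ w e, e ∈ M ∧ tail e = w ↔ e = m w := by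
      intro w e
      constructor
      · rintro ⟨he, rfl⟩
        obtain ⟨w, -, rfl⟩ := Finset.mem_image.1 he
        rw [(hm w).2]
      · rintro rfl
        exact ⟨hmM w, (hm w).2⟩
    have hMhead : ∀ w, ∃ v, ∀ e, e ∈ M ∧ head e = w ↔ e = m v := by
      intro w
      obtain ⟨v, rfl⟩ := hgbij.2 w
      refine ⟨v, fun e => ⟨?_, ?_⟩⟩
      · rintro ⟨he, hw⟩
        obtain ⟨w, -, rfl⟩ := Finset.mem_image.1 he
        rw [hginj ((hmg w).symm.trans hw)]
      · rintro rfl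
        exact ⟨hmM v, hmg v⟩
    have hdrop : ∀ (p : E → W) (w v : W), (∀ e, e ∈ M ∧ p e = w ↔ e = m v) →
        (F.filter fun e => p e = w).card = k + 1 →
        ((F \ M).filter fun e => p e = w).card = k := by
      intro p w v h hc
      have : (F \ M).filter (fun e => p e = w) = (F.filter fun e => p e = w).erase (m v) := by
        ext e
        have := h e
        simp only [Finset.mem_filter, Finset.mem_sdiff, Finset.mem_erase]
        tauto
      rw [this, Finset.card_erase_of_mem (Finset.mem_filter.2 ⟨(hm v).1, ((h _).2 rfl).2⟩), hc,
        Nat.add_sub_cancel]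
    obtain ⟨c, hc, hcinj⟩ := ih (F \ M) (fun w => hdrop tail w w (hMtail w) (htail w))
      (fun w => (hMhead w).elim fun v hv => hdrop head w v hv (hhead w))
    refine ⟨fun e => if e ∈ M then k else c e, fun e he => ?_, fun e he e' he' hee h => ?_⟩
    · by_cases heM : e ∈ M
      · simp [heM]
      · have := hc e (Finset.mem_sdiff.2 ⟨he, heM⟩)
        simp only [heM, if_false]; omega
    · by_cases heM : e ∈ M <;> by_cases heM' : e' ∈ M <;>
        simp only [heM, heM', if_true, if_false] at hee
      · rcases h with h | h
        · exact ((hMtail _ e).1 ⟨heM, h⟩).trans ((hMtail _ e').1 ⟨heM', rfl⟩).symm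
        · obtain ⟨v, hv⟩ := hMhead (head e')
          exact ((hv e).1 ⟨heM, h⟩).trans ((hv e').1 ⟨heM', rfl⟩).symm
      · exact absurd hee (hc e' (Finset.mem_sdiff.2 ⟨he', heM'⟩)).ne'
      · exact absurd hee (hc e (Finset.mem_sdiff.2 ⟨he, heM⟩)).ne
      · exact hcinj e (Finset.mem_sdiff.2 ⟨he, heM⟩) e' (Finset.mem_sdiff.2 ⟨he', heM'⟩) hee h

/-- The degree of a vertex counts the edges starting at it and the edges ending at it, for any
choice of the two ends of each edge. -/
theorem SimpleGraph.sum_ends_eq_degree {V : Type*} [Fintype V] [DecidableEq V]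
    (G : SimpleGraph V) [DecidableRel G.Adj] (a b : G.edgeSet → V)
    (hab : ∀ e, s(a e, b e) = (e : Sym2 V)) (v : V) :
    ∑ e, ((if a e = v then 1 else 0) + if b e = v then 1 else 0) = G.degree v := by
  have hne : ∀ e, a e ≠ b e := fun e => by
    have := e.2
    rw [← hab e, SimpleGraph.mem_edgeSet] at this
    exact this.ne
  have hmem : ∀ e : G.edgeSet, v ∈ (e : Sym2 V) ↔ a e = v ∨ b e = v := fun e => by
    rw [← hab e, Sym2.mem_iff]
    tauto
  have hterm : ∀ e : G.edgeSet, ((if a e = v then 1 else 0) + if b e = v then 1 else 0) =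
      if v ∈ (e : Sym2 V) then 1 else 0 := fun e => by
    have := hne e
    simp only [hmem e]
    by_cases h1 : a e = v <;> by_cases h2 : b e = v <;> simp [h1, h2]
    exact this (h1.trans h2.symm)
  rw [Finset.sum_congr rfl fun e _ => hterm e, ← G.card_incidenceFinset_eq_degree v,
    G.incidenceFinset_eq_filter, Finset.card_filter]
  exact (Finset.sum_subtype G.edgeFinset (fun e => SimpleGraph.mem_edgeFinset)
    fun e => if v ∈ e then 1 else 0).symm

/-- If every vertex of a finite simple graph `G` has degree at most `2 * k` (with `k ≥ 1`),
then there are `k` partial bijections `f 0, …, f (k-1)` of the vertex set (modelled as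
partial equivalences `PEquiv V V`) such that:
(i) each `f j` moves vertices only along edges of `G`;
(ii) each `f j` has no 2-cycles;
(iii) the sets of edges realized by distinct `f j` are disjoint; and
(iv) every edge of `G` is realized by some `f j`. -/
theorem exists_partial_bijections_of_degree_le {V : Type*} [Fintype V] [DecidableEq V]
    (G : SimpleGraph V) [DecidableRel G.Adj] (k : ℕ) (hk : 1 ≤ k)
    (hdeg : ∀ v : V, G.degree v ≤ 2 * k) :
    ∃ f : Fin k → PEquiv V V,
      (∀ (j : Fin k) (x y : V), f j x = some y → G.Adj x y) ∧
      (∀ (j : Fin k) (x y : V), f j x = some y → f j y ≠ some x) ∧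
      (∀ (j j' : Fin k), j ≠ j' → ∀ x y : V,
        (f j x = some y ∨ f j y = some x) → ¬ (f j' x = some y ∨ f j' y = some x)) ∧
      (∀ x y : V, G.Adj x y → ∃ j : Fin k, f j x = some y ∨ f j y = some x) := by
  classical
  have hout : ∀ e : G.edgeSet, ∃ p : V × V, s(p.1, p.2) = (e : Sym2 V) :=
    fun e => ⟨Quot.out e.1, Quot.out_eq e.1⟩
  choose p hp using hout
  let E := (G.edgeSet × Bool) ⊕ (Σ v : V, Fin (2 * k - G.degree v))
  let src : E → V × Bool := Sum.elim (fun e => ((p e.1).1, e.2)) fun d => (d.1, false)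
  let tgt : E → V × Bool := Sum.elim (fun e => ((p e.1).2, e.2)) fun d => (d.1, true)
  obtain ⟨tail, head, hends, htail, hhead⟩ := exists_balanced_orientation_s1 k src tgt (by
    rintro ⟨v, b⟩
    have hd := G.sum_ends_eq_degree (fun e => (p e).1) (fun e => (p e).2) hp v
    have hv := hdeg v
    rw [Finset.sum_add_distrib] at hd
    simp only [Fintype.card_subtype, Finset.card_filter, E, src, tgt, Fintype.sum_sum_type,
      Fintype.sum_prod_type, Fintype.sum_sigma, Sum.elim_inl, Sum.elim_inr, Prod.mk.injEq]
    cases b <;> simp [-Finset.sum_boole] <;> omega)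
  simp only [Fintype.card_subtype] at htail hhead
  obtain ⟨c, hc, hcinj⟩ := exists_edge_coloring_of_regular_s1 tail head k Finset.univ htail hhead
  simp only [Finset.mem_univ, true_implies] at hc hcinj
  let ι : G.edgeSet → E := fun e => Sum.inl (e, false)
  have hedge : ∀ e x y, tail (ι e) = (x, false) → head (ι e) = (y, false) →
      (e : Sym2 V) = s(x, y) := by
    intro e x y hx hy
    rw [← hp e, Sym2.eq_iff]
    rcases hends (ι e) with ⟨h1, h2⟩ | ⟨h1, h2⟩
    · left
      exact ⟨congrArg Prod.fst (h1.symm.trans hx), congrArg Prod.fst (h2.symm.trans hy)⟩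
    · right
      exact ⟨congrArg Prod.fst (h2.symm.trans hy), congrArg Prod.fst (h1.symm.trans hx)⟩
  have hR : ∀ j : Fin k, ∃ f : PEquiv V V, ∀ x y, f x = some y ↔
      ∃ e, c (ι e) = j ∧ tail (ι e) = (x, false) ∧ head (ι e) = (y, false) := by
    intro j
    refine PEquiv.exists_eq_some_iff _ ?_ ?_
    · rintro x y y' ⟨e, hj, hx, hy⟩ ⟨e', hj', hx', hy'⟩
      rw [hcinj _ _ (hj.trans hj'.symm) (Or.inl (hx.trans hx'.symm))] at hy
      exact congrArg Prod.fst (hy.symm.trans hy')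
    · rintro x x' y ⟨e, hj, hx, hy⟩ ⟨e', hj', hx', hy'⟩
      rw [hcinj _ _ (hj.trans hj'.symm) (Or.inr (hy.trans hy'.symm))] at hx
      exact congrArg Prod.fst (hx.symm.trans hx')
  choose f hf using hR
  have hadj : ∀ (j : Fin k) (x y : V), f j x = some y → G.Adj x y := by
    intro j x y h
    obtain ⟨e, -, hx, hy⟩ := (hf j x y).1 h
    have := e.2
    rwa [hedge e x y hx hy, SimpleGraph.mem_edgeSet] at this
  have hcolor : ∀ (j : Fin k) (x y : V), f j x = some y ∨ f j y = some x →
      ∃ e : G.edgeSet, (e : Sym2 V) = s(x, y) ∧ c (ι e) = j := by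
    rintro j x y (h | h)
    · obtain ⟨e, hj, hx, hy⟩ := (hf j x y).1 h
      exact ⟨e, hedge e x y hx hy, hj⟩
    · obtain ⟨e, hj, hx, hy⟩ := (hf j y x).1 h
      exact ⟨e, (hedge e y x hx hy).trans Sym2.eq_swap, hj⟩
  refine ⟨f, hadj, fun j x y h h' => ?_, fun j j' hjj x y h h' => ?_, fun x y h => ?_⟩
  · obtain ⟨e, -, hx, hy⟩ := (hf j x y).1 h
    obtain ⟨e', -, hx', hy'⟩ := (hf j y x).1 h'
    have hee : e = e' := Subtype.ext
      ((hedge e x y hx hy).trans (Sym2.eq_swap.trans (hedge e' y x hx' hy').symm))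
    rw [hee] at hx
    exact (hadj j x y h).ne (congrArg Prod.fst (hx.symm.trans hx'))
  · obtain ⟨e, he, hj⟩ := hcolor j x y h
    obtain ⟨e', he', hj'⟩ := hcolor j' x y h'
    have hee : e = e' := Subtype.ext (he.trans he'.symm)
    rw [hee] at hj
    exact hjj (Fin.ext (hj.symm.trans hj'))
  · let e : G.edgeSet := ⟨s(x, y), h⟩
    refine ⟨⟨c (ι e), hc _⟩, ?_⟩
    have hsrc : src (ι e) = ((p e).1, false) := rfl
    have htgt : tgt (ι e) = ((p e).2, false) := rfl
    have hpe : s((p e).1, (p e).2) = s(x, y) := hp e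
    rw [hf, hf]
    have he := hends (ι e)
    rw [hsrc, htgt] at he
    rcases Sym2.eq_iff.1 hpe with ⟨h1, h2⟩ | ⟨h1, h2⟩ <;> rw [h1, h2] at he <;>
      rcases he with he | he
    · exact Or.inl ⟨e, rfl, he⟩
    · exact Or.inr ⟨e, rfl, he⟩
    · exact Or.inr ⟨e, rfl, he⟩
    · exact Or.inl ⟨e, rfl, he⟩
end

section
/- Let X be a set, let S be a subset of X, and let f : S → X be an injective map with f(x) ≠ x for every x ∈ S. Then X can be partitioned into three sets A_0, A_1, A_2 such that for each i ∈ {0,1,2} and each x ∈ S ∩ A_i, one has f(x) ∉ A_i. -/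
/-- On a finite set, an injective fixed-point-free partial map admits a colouring with three colours
in which no point has the same colour as its image. -/
theorem exists_fin_three_coloring_of_finset {X : Type*} {S : Set X}
    (f : S → X) (hinj : Function.Injective f) (hne : ∀ x : S, f x ≠ (x : X)) (s : Finset X) :
    ∃ c : X → Fin 3, ∀ x : S, (x : X) ∈ s → f x ∈ s → c x ≠ c (f x) := by
  classical
  induction s using Finset.induction_on with
  | empty => exact ⟨fun _ => 0, by simp⟩
  | insert a s ha ih =>
    obtain ⟨c, hc⟩ := ih
    obtain ⟨p, hp⟩ : ∃ p : Fin 3, ∀ x : S, f x = a → c x = p := by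
      by_cases h : ∃ y : S, f y = a
      · obtain ⟨y, hy⟩ := h
        exact ⟨c y, fun x hx => by rw [hinj (hx.trans hy.symm)]⟩
      · exact ⟨0, fun x hx => (h ⟨x, hx⟩).elim⟩
    obtain ⟨q, hq⟩ : ∃ q : Fin 3, ∀ x : S, (x : X) = a → c (f x) = q := by
      by_cases h : a ∈ S
      · exact ⟨c (f ⟨a, h⟩), fun x hx => by rw [Subtype.ext (a2 := ⟨a, h⟩) hx]⟩
      · exact ⟨0, fun x hx => (h (hx ▸ x.2)).elim⟩
    obtain ⟨k, hkp, hkq⟩ : ∃ k : Fin 3, k ≠ p ∧ k ≠ q := by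
      exact (by decide : ∀ p q : Fin 3, ∃ k, k ≠ p ∧ k ≠ q) p q
    refine ⟨Function.update c a k, fun x hx hfx => ?_⟩
    have := hne x
    have := hp x
    have := hq x
    have := hc x
    simp only [Function.update_apply, Finset.mem_insert] at *
    grind

/-- An injective fixed-point-free partial map admits a colouring with three colours in which no
point has the same colour as its image. -/
theorem exists_fin_three_coloring {X : Type*} {S : Set X}
    (f : S → X) (hinj : Function.Injective f) (hne : ∀ x : S, f x ≠ (x : X)) :
    ∃ c : X → Fin 3, ∀ x : S, c x ≠ c (f x) := by
  classical
  choose g hg using exists_fin_three_coloring_of_finset f hinj hne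
  obtain ⟨c, hc⟩ := Finset.rado_selection (β := fun _ : X => Fin 3) g
  refine ⟨c, fun x => ?_⟩
  obtain ⟨t, hst, ht⟩ := hc {(x : X), f x}
  rw [ht x (by simp), ht (f x) (by simp)]
  exact hg t x (hst (by simp)) (hst (by simp))

/-- Let `X` be a set, `S ⊆ X`, and `f : S → X` an injective map with no fixed points.
Then `X` can be partitioned into three sets `A 0, A 1, A 2` such that `f` maps points of
`S ∩ A i` out of `A i`, for each `i`. -/
theorem exists_three_partition_of_injective_fixedPointFree {X : Type*} {S : Set X}
    (f : S → X) (hinj : Function.Injective f) (hne : ∀ x : S, f x ≠ (x : X)) :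
    ∃ A : Fin 3 → Set X,
      (∀ i j : Fin 3, i ≠ j → Disjoint (A i) (A j)) ∧
      (⋃ i, A i) = Set.univ ∧
      (∀ (i : Fin 3) (x : S), (x : X) ∈ A i → f x ∉ A i) := by
  obtain ⟨c, hc⟩ := exists_fin_three_coloring f hinj hne
  refine ⟨fun i => c ⁻¹' {i}, fun i j hij => ?_, ?_, fun i x hx hfx => hc x (hx.trans hfx.symm)⟩
  · exact Disjoint.preimage c (Set.disjoint_singleton.2 hij)
  · exact Set.eq_univ_of_forall fun x => Set.mem_iUnion.2 ⟨c x, rfl⟩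
end

section
/- Let X be a set, let ω be an ultrafilter on X, let S ∈ ω, and let f : X → X be a map whose restriction to S is injective and which satisfies f(x) ≠ x for all x ∈ S. Then the pushforward ultrafilter f_*(ω) is different from ω. -/
/-- Every set without fixed points of `f` contains a subset `A` disjoint from its image under `f`,
maximal in the sense that every point of `S` lies in `A`, in `f ⁻¹' A` or in `f '' A`. -/
theorem exists_subset_forall_notMem_and_subset_union {X : Type*} (S : Set X) (f : X → X)
    (hne : ∀ x ∈ S, f x ≠ x) :
    ∃ A ⊆ S, (∀ a ∈ A, f a ∉ A) ∧ S ⊆ A ∪ (f ⁻¹' A ∪ f '' A) := by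
  obtain ⟨A, hA⟩ := zorn_subset {A : Set X | A ⊆ S ∧ ∀ a ∈ A, f a ∉ A} (by
    intro c hc hchain
    refine ⟨⋃₀ c, ⟨Set.sUnion_subset fun B hB => (hc hB).1, ?_⟩,
      fun B hB => Set.subset_sUnion_of_mem hB⟩
    rintro a ⟨B, hB, haB⟩ ⟨C, hC, haC⟩
    rcases hchain.total hB hC with h | h
    · exact (hc hC).2 a (h haB) haC
    · exact (hc hB).2 a haB (h haC))
  refine ⟨A, hA.prop.1, hA.prop.2, fun x hx => ?_⟩
  by_contra hcon
  simp only [Set.mem_union, Set.mem_preimage, Set.mem_image, not_or, not_exists, not_and] at hcon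
  obtain ⟨hxA, hfx, him⟩ := hcon
  refine hxA (hA.le_of_ge (y := insert x A) ⟨Set.insert_subset hx hA.prop.1, ?_⟩
    (Set.subset_insert x A) (Set.mem_insert x A))
  rintro a (rfl | ha) (h | h)
  · exact hne _ hx h
  · exact hfx h
  · exact him a ha h
  · exact hA.prop.2 a ha h

/-- Let `ω` be an ultrafilter on `X`, let `S ∈ ω`, and let `f : X → X` be injective on `S`
with `f x ≠ x` for all `x ∈ S`.  Then the pushforward ultrafilter `f⋆ω` differs from `ω`. -/
theorem ultrafilter_map_ne_of_injOn_fixedPointFree {X : Type*} (ω : Ultrafilter X)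
    (S : Set X) (hS : S ∈ ω) (f : X → X) (hinj : Set.InjOn f S)
    (hne : ∀ x ∈ S, f x ≠ x) :
    Ultrafilter.map f ω ≠ ω := by
  intro hω
  have hpre (B : Set X) : f ⁻¹' B ∈ ω ↔ B ∈ ω := by rw [← Ultrafilter.mem_map, hω]
  obtain ⟨A, hAS, hdisj, hcover⟩ := exists_subset_forall_notMem_and_subset_union S f hne
  have hA : A ∉ ω := fun h => by
    obtain ⟨a, ha, hfa⟩ := ω.nonempty_of_mem (Filter.inter_mem h ((hpre A).2 h))
    exact hdisj a ha hfa
  rcases Ultrafilter.union_mem_iff.1 (Filter.mem_of_superset hS hcover) with h | h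
  · exact hA h
  rcases Ultrafilter.union_mem_iff.1 h with h | h
  · exact hA ((hpre A).1 h)
  · refine hA (Filter.mem_of_superset (Filter.inter_mem hS ((hpre _).2 h)) ?_)
    rintro x ⟨hx, a, ha, hax⟩
    exact hinj (hAS ha) hx hax ▸ ha
end
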